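/- Let r ≥ 1 and let a₁, …, a_r and b₁, …, b_r be real numbers. Let F be the 2r×2r real matrix, viewed as an r×r array of 2×2 blocks, whose (j, j) diagonal blocks are [[−a_j, 1], [−b_j, 0]] for 1 ≤ j ≤ r, whose (j, j+1) superdiagonal blocks are [[0, 0], [0, 1]] for 1 ≤ j ≤ r−1, whose (j+1, j) subdiagonal blocks are [[0, a_{j+1}], [0, b_{j+1}]] for 1 ≤ j ≤ r−1, and whose remaining blocks are zero. Then det F = ∏_{j=1}^{r} b_j. -/

import Mathlib

/-- The unipotent matrix whose right multiplication adds column `q + 1` to each odd column `q`. -/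
def addNextColumn (n : ℕ) : Matrix (Fin n) (Fin n) ℝ :=
  1 + Matrix.of fun k q : Fin n => if (q : ℕ) % 2 = 1 ∧ (k : ℕ) = q + 1 then 1 else 0

theorem det_addNextColumn (n : ℕ) : (addNextColumn n).det = 1 := by
  rw [Matrix.det_of_isLowerTriangular]
  · refine Finset.prod_eq_one fun i _ => ?_
    simp [addNextColumn]
  · intro i j hij
    have hlt : (i : ℕ) < j := hij
    have hne : i ≠ j := Fin.ne_of_lt hlt
    have hsucc : (i : ℕ) ≠ j + 1 := by omega
    simp [addNextColumn, hne, hsucc]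

theorem mul_addNextColumn_apply {n : ℕ} (F : Matrix (Fin n) (Fin n) ℝ) (p q : Fin n) :
    (F * addNextColumn n) p q =
      F p q + if h : (q : ℕ) % 2 = 1 ∧ (q : ℕ) + 1 < n then F p ⟨q + 1, h.2⟩ else 0 := by
  rw [addNextColumn, mul_add, mul_one, Matrix.add_apply, Matrix.mul_apply]
  congr 1
  split_ifs with h
  · rw [Finset.sum_eq_single ⟨q + 1, h.2⟩]
    · simp [h.1]
    · intro k _ hk
      have hne : (k : ℕ) ≠ q + 1 := fun e => hk (Fin.ext e)
      simp [hne]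
    · simp
  · refine Finset.sum_eq_zero fun k _ => ?_
    have hk : ¬((q : ℕ) % 2 = 1 ∧ (k : ℕ) = q + 1) := by
      have := k.isLt
      omega
    simp [hk]

/-- The two indices of the `k`-th block of size two. -/
def blockIndexEquiv {r : ℕ} (k : Fin r) :
    Fin 2 ≃ {p : Fin (2 * r) // (⟨(p : ℕ) / 2, by omega⟩ : Fin r) = k} where
  toFun i := ⟨⟨2 * k + i, by omega⟩, Fin.ext (by simp only; omega)⟩
  invFun p := ⟨(p : ℕ) % 2, by omega⟩
  left_inv i := Fin.ext (by simp only; omega)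
  right_inv p := by
    obtain ⟨p, rfl⟩ := p
    exact Subtype.ext (Fin.ext (by simp only; omega))

/-- A matrix that is block upper triangular with `2 × 2` blocks has determinant the product of the
determinants of its diagonal blocks. -/
theorem det_eq_prod_of_two_blockTriangular {r : ℕ} (G : Matrix (Fin (2 * r)) (Fin (2 * r)) ℝ)
    (hG : ∀ p q : Fin (2 * r), (q : ℕ) / 2 < (p : ℕ) / 2 → G p q = 0) :
    G.det = ∏ k : Fin r,
      (G ⟨2 * k, by omega⟩ ⟨2 * k, by omega⟩ * G ⟨2 * k + 1, by omega⟩ ⟨2 * k + 1, by omega⟩ -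
        G ⟨2 * k, by omega⟩ ⟨2 * k + 1, by omega⟩ *
          G ⟨2 * k + 1, by omega⟩ ⟨2 * k, by omega⟩) := by
  have hT : G.BlockTriangular fun p => (⟨(p : ℕ) / 2, by omega⟩ : Fin r) :=
    fun p q hpq => hG p q hpq
  rw [hT.det_fintype]
  refine Finset.prod_congr rfl fun k _ => ?_
  rw [← Matrix.det_submatrix_equiv_self (blockIndexEquiv k), Matrix.det_fin_two]
  rfl

/-- Determinant of the block-tridiagonal low-power observer matrix: with 2×2
diagonal blocks `[[−a_j, 1], [−b_j, 0]]`, superdiagonal blocks `[[0,0],[0,1]]`,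
subdiagonal blocks `[[0, a_j],[0, b_j]]` (block row `j`), and zero elsewhere,
the determinant equals `∏ j, b_j`.  Here blocks are 0-indexed: row `p` of the
`2r × 2r` matrix belongs to block row `p / 2` and has in-block index `p % 2`. -/
theorem stmt_14 (r : ℕ) (hr : 1 ≤ r) (a b : Fin r → ℝ)
    (F : Matrix (Fin (2 * r)) (Fin (2 * r)) ℝ)
    (hF : ∀ p q : Fin (2 * r),
      F p q =
        (if h : (p : ℕ) / 2 = (q : ℕ) / 2 then
          -- diagonal block [[−a_j, 1], [−b_j, 0]]
          (if (p : ℕ) % 2 = 0 then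
            (if (q : ℕ) % 2 = 0 then -a ⟨(p : ℕ) / 2, by omega⟩ else 1)
          else
            (if (q : ℕ) % 2 = 0 then -b ⟨(p : ℕ) / 2, by omega⟩ else 0))
        else if (q : ℕ) / 2 = (p : ℕ) / 2 + 1 then
          -- superdiagonal block [[0, 0], [0, 1]]
          (if (p : ℕ) % 2 = 1 ∧ (q : ℕ) % 2 = 1 then 1 else 0)
        else if h' : (p : ℕ) / 2 = (q : ℕ) / 2 + 1 then
          -- subdiagonal block [[0, a_j], [0, b_j]] in block row j = p/2
          (if (q : ℕ) % 2 = 1 then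
            (if (p : ℕ) % 2 = 0 then a ⟨(p : ℕ) / 2, by omega⟩
             else b ⟨(p : ℕ) / 2, by omega⟩)
           else 0)
        else 0)) :
    F.det = ∏ j, b j := by
  have hdet : F.det = (F * addNextColumn (2 * r)).det := by
    rw [Matrix.det_mul, det_addNextColumn, mul_one]
  rw [hdet, det_eq_prod_of_two_blockTriangular]
  · refine Finset.prod_congr rfl fun k _ => ?_
    have hdiv : (2 * (k : ℕ) + 1) / 2 = k := by omega
    have hdiv' : (2 * (k : ℕ) + 1 + 1) / 2 = k + 1 := by omega
    have hmod : (2 * (k : ℕ) + 1 + 1) % 2 = 0 := by omega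
    simp [mul_addNextColumn_apply, hF, hdiv, hdiv', hmod]
  · intro p q hqp
    rw [mul_addNextColumn_apply]
    simp only [hF]
    grind
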